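/- arXiv:1409.2308 — 2 statements merged into one kernel-verified Lean document; each statement's English description precedes it below -/
import Mathlib

section
/- (Rhodes–Tilson) Let S be a finite semigroup and let s ∈ K(S) be a regular element, i.e., there exists x ∈ S with s·x·s = s. Then s ∈ D(S). In other words, every regular type II element lies in the smallest subsemigroup of S containing the idempotents and closed under weak conjugation. -/
/-- An element `s` of a (finite) semigroup `S` is of *type II* if for every finite group `G`
and every relational morphism `R` from `S` to `G` (a subsemigroup of `S × G` projecting onto
`S`) one has `(s, 1) ∈ R`.  The set of type II elements is the group kernel `K(S)`. -/
def IsTypeII {S : Type} [Semigroup S] (s : S) : Prop :=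
  ∀ (G : Type) [Group G] [Finite G] (R : Subsemigroup (S × G)),
    (∀ x : S, ∃ g : G, (x, g) ∈ R) → (s, (1 : G)) ∈ R

/-- A subsemigroup `T` of `S` is closed under weak conjugation if whenever `s·t·s = s`,
`s·T·t ⊆ T` and `t·T·s ⊆ T`. -/
def WeakConjClosed {S : Type} [Semigroup S] (T : Subsemigroup S) : Prop :=
  ∀ s t : S, s * t * s = s → ∀ x ∈ T, s * x * t ∈ T ∧ t * x * s ∈ T

/-- `D(S)`: the smallest subsemigroup of `S` containing all idempotents and closed under
weak conjugation. -/
def DSub (S : Type) [Semigroup S] : Subsemigroup S :=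
  sInf {T : Subsemigroup S | (∀ e : S, e * e = e → e ∈ T) ∧ WeakConjClosed T}

theorem idempotent_mem_DSub {S : Type} [Semigroup S] {e : S} (he : e * e = e) : e ∈ DSub S :=
  Subsemigroup.mem_sInf.2 fun _ hT => hT.1 e he

theorem weakConjClosed_DSub (S : Type) [Semigroup S] : WeakConjClosed (DSub S) :=
  fun s t h x hx =>
    ⟨Subsemigroup.mem_sInf.2 fun T hT => (hT.2 s t h x (Subsemigroup.mem_sInf.1 hx T hT)).1,
      Subsemigroup.mem_sInf.2 fun T hT => (hT.2 s t h x (Subsemigroup.mem_sInf.1 hx T hT)).2⟩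

/-- The elements all of whose weak inverses lie in `D(S)`. -/
def weakInvSub (S : Type) [Semigroup S] : Subsemigroup S where
  carrier := {u | ∀ v, v * u * v = v → v ∈ DSub S}
  mul_mem' := by
    intro u w hu hw v hv
    have h1 : w * v ∈ DSub S := hu _ (by
      calc w * v * u * (w * v) = w * (v * (u * w) * v) := by simp only [mul_assoc]
        _ = w * v := by rw [hv])
    have h2 : v * u ∈ DSub S := hw _ (by
      calc v * u * w * (v * u) = v * (u * w) * v * u := by simp only [mul_assoc]
        _ = v * u := by rw [hv])
    have h3 : v * u * (w * v) = v := by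
      rw [← hv]
      simp only [mul_assoc] at hv ⊢
      simp only [hv]
    exact h3 ▸ mul_mem h2 h1

theorem weakConjClosed_weakInvSub (S : Type) [Semigroup S] : WeakConjClosed (weakInvSub S) := by
  intro s t hst d hd
  constructor
  · intro v hv
    have hX : t * v * s ∈ DSub S := hd _ (by
      calc t * v * s * d * (t * v * s) = t * (v * (s * d * t) * v) * s := by
            simp only [mul_assoc]
        _ = t * v * s := by rw [hv])
    have hw : v * s * d * t * (v * s * d) = v * s * d := by
      calc v * s * d * t * (v * s * d) = v * (s * d * t) * v * (s * d) := by
            simp only [mul_assoc]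
        _ = v * s * d := by rw [hv, mul_assoc]
    have h1 : v * s * t ∈ DSub S := by
      have := (weakConjClosed_DSub S _ _ hw _ hX).1
      rwa [show v * s * d * (t * v * s) * t = v * (s * d * t) * v * (s * t) by
        simp only [mul_assoc], hv, ← mul_assoc] at this
    have h2 : s * d * t * v ∈ DSub S := idempotent_mem_DSub (by
      rw [show s * d * t * v * (s * d * t * v) = s * d * t * (v * (s * d * t) * v) by
        simp only [mul_assoc], hv])
    have h3 := mul_mem h1 h2
    rwa [show v * s * t * (s * d * t * v) = v * (s * t * s * d * t) * v by
      simp only [mul_assoc], hst, hv] at h3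
  · intro v hv
    have hX : s * v * t ∈ DSub S := hd _ (by
      calc s * v * t * d * (s * v * t) = s * (v * (t * d * s) * v) * t := by
            simp only [mul_assoc]
        _ = s * v * t := by rw [hv])
    have hw : d * s * v * t * (d * s * v) = d * s * v := by
      calc d * s * v * t * (d * s * v) = d * s * (v * (t * d * s) * v) := by
            simp only [mul_assoc]
        _ = d * s * v := by rw [hv]
    have h1 : t * s * v ∈ DSub S := by
      have := (weakConjClosed_DSub S _ _ hw _ hX).2
      rwa [show t * (s * v * t) * (d * s * v) = t * s * (v * (t * d * s) * v) by
        simp only [mul_assoc], hv] at this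
    have h2 : v * (t * d * s) ∈ DSub S := idempotent_mem_DSub (by
      rw [← mul_assoc, hv])
    have h3 := mul_mem h2 h1
    rwa [show v * (t * d * s) * (t * s * v) = v * (t * d * (s * t * s)) * v by
      simp only [mul_assoc], hst, hv] at h3

/-- `D(S)` is closed under weak inverses. -/
theorem weakInv_mem_DSub {S : Type} [Semigroup S] {u v : S} (hu : u ∈ DSub S)
    (hv : v * u * v = v) : v ∈ DSub S := by
  refine Subsemigroup.mem_sInf.1 hu (weakInvSub S) ⟨?_, weakConjClosed_weakInvSub S⟩ v hv
  intro e he v hv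
  have h1 : v * e ∈ DSub S := idempotent_mem_DSub (by rw [← mul_assoc, hv])
  have h2 : e * v ∈ DSub S := idempotent_mem_DSub (by
    rw [mul_assoc, ← mul_assoc v, hv])
  have h3 := mul_mem h1 h2
  rwa [show v * e * (e * v) = v * (e * e) * v by simp only [mul_assoc], he, hv] at h3

/-- A partial bijection of a finite type extends to a permutation. -/
theorem exists_perm_of_biUnique {Q : Type*} [Finite Q] (ρ : Q → Q → Prop)
    (hρ : Relator.BiUnique ρ) : ∃ π : Equiv.Perm Q, ∀ a b, ρ a b → π a = b := by
  classical
  have := Fintype.ofFinite Q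
  choose f hf using fun a : {a // ∃ b, ρ a b} => a.2
  let F : {a // ∃ b, ρ a b} → {b // ∃ a, ρ a b} := fun a => ⟨f a, a, hf a⟩
  have hF : Function.Bijective F := by
    constructor
    · intro a a' h
      have h' : f a = f a' := congrArg Subtype.val h
      exact Subtype.ext (hρ.1 (hf a) (h' ▸ hf a'))
    · rintro ⟨b, a, h⟩
      exact ⟨⟨a, b, h⟩, Subtype.ext (hρ.2 (hf _) h)⟩
  refine ⟨(Equiv.ofBijective F hF).extendSubtype, fun a b h => ?_⟩
  rw [Equiv.extendSubtype_apply_of_mem _ a ⟨b, h⟩]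
  exact hρ.2 (hf _) h

/-- The elements `R`-equivalent to `s` (for `s` regular). -/
def rClass {S : Type} [Semigroup S] (s : S) : Set S :=
  {r | (∃ y, r * y = s) ∧ ∃ z, s * z = r}

theorem rClass.exists_mul_eq {S : Type} [Semigroup S] {s r p : S} (hr : r ∈ rClass s)
    (hp : p ∈ rClass s) : ∃ y, r * y = p := by
  obtain ⟨⟨y, hy⟩, -⟩ := hr
  obtain ⟨-, z, hz⟩ := hp
  exact ⟨y * z, by rw [← mul_assoc, hy, hz]⟩

theorem rClass.regular {S : Type} [Semigroup S] {s r : S} (hs : ∃ x, s * x * s = s)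
    (hr : r ∈ rClass s) : ∃ a, r * a * r = r := by
  obtain ⟨x, hx⟩ := hs
  obtain ⟨⟨y, hy⟩, z, hz⟩ := hr
  exact ⟨y * x, by
    calc r * (y * x) * r = r * y * x * (s * z) := by rw [hz, mul_assoc r y x]
      _ = s * x * s * z := by rw [hy]; simp only [mul_assoc]
      _ = r := by rw [hx, hz]⟩

/-- If `r` and `r * x` are `R`-equivalent and regular, some weak inverse of `x` takes `r * x`
back to `r`. -/
theorem exists_weakInv {S : Type} [Semigroup S] {r x : S} (hr : ∃ a, r * a * r = r)
    (hx : ∃ y, r * x * y = r) : ∃ v, v * x * v = v ∧ r * x * v = r := by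
  obtain ⟨a, ha⟩ := hr
  obtain ⟨y, hy⟩ := hx
  refine ⟨y * (a * r), ?_, ?_⟩
  · calc y * (a * r) * x * (y * (a * r)) = y * (a * (r * x * y * a * r)) := by
          simp only [mul_assoc]
      _ = y * (a * r) := by rw [hy, ha]
  · rw [← mul_assoc, hy, ← mul_assoc, ha]

/-- Two elements of an `R`-class are related when right multiplication by some element of `D(S)`
takes one to the other. -/
def rClassSetoid {S : Type} [Semigroup S] {s : S} (hs : ∃ x, s * x * s = s) :
    Setoid (rClass s) where
  r p q := ∃ d ∈ DSub S, p.1 * d = q.1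
  iseqv :=
    { refl := fun r => by
        obtain ⟨a, ha⟩ := rClass.regular hs r.2
        exact ⟨a * r, idempotent_mem_DSub (by rw [mul_assoc, ← mul_assoc r.1, ha]), by
          rw [← mul_assoc, ha]⟩
      symm := by
        rintro p q ⟨d, hd, h⟩
        obtain ⟨v, hv, hpv⟩ := exists_weakInv (x := d) (rClass.regular hs p.2)
          (h ▸ rClass.exists_mul_eq q.2 p.2)
        exact ⟨v, weakInv_mem_DSub hd hv, h ▸ hpv⟩
      trans := by
        rintro p q r ⟨d, hd, h⟩ ⟨d', hd', h'⟩
        exact ⟨d * d', mul_mem hd hd', by rw [← mul_assoc, h, h']⟩ }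

/-- Rhodes–Tilson: every regular type II element of a finite semigroup `S`
lies in `D(S)`, the smallest subsemigroup of `S` containing the idempotents and closed
under weak conjugation. -/
theorem regular_type_II_in_D (S : Type) [Semigroup S] [Finite S] (s : S)
    (hreg : ∃ x : S, s * x * s = s) (hII : IsTypeII s) :
    s ∈ DSub S := by
  let σ := rClassSetoid hreg
  let ρ (x : S) (a b : Quotient σ) : Prop :=
    ∃ r p : rClass s, r.1 * x = p.1 ∧ Quotient.mk σ p = a ∧ Quotient.mk σ r = b
  have hρ (x : S) : Relator.BiUnique (ρ x) := by
    constructor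
    · rintro _ _ _ ⟨r, p, h, rfl, rfl⟩ ⟨r', p', h', rfl, hr⟩
      obtain ⟨d, hd, hrd⟩ := Quotient.exact hr.symm
      obtain ⟨v, hv, hpv⟩ := exists_weakInv (x := x) (rClass.regular hreg r.2)
        (h ▸ rClass.exists_mul_eq p.2 r.2)
      refine Quotient.sound ⟨v * d * x, (weakConjClosed_DSub S _ _ hv _ hd).1, ?_⟩
      calc p.1 * (v * d * x) = r.1 * x * v * d * x := by rw [h]; simp only [mul_assoc]
        _ = p'.1 := by rw [hpv, hrd, h']
    · rintro _ _ _ ⟨r, p, h, rfl, rfl⟩ ⟨r', p', h', hp, rfl⟩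
      obtain ⟨d, hd, hpd⟩ := Quotient.exact hp.symm
      obtain ⟨v, hv, hpv⟩ := exists_weakInv (x := x) (rClass.regular hreg r'.2)
        (h' ▸ rClass.exists_mul_eq p'.2 r'.2)
      refine Quotient.sound ⟨x * d * v, (weakConjClosed_DSub S _ _ hv _ hd).2, ?_⟩
      calc r.1 * (x * d * v) = r.1 * x * d * v := by simp only [mul_assoc]
        _ = r'.1 := by rw [h, hpd, ← h', hpv]
  let R : Subsemigroup (S × Equiv.Perm (Quotient σ)) :=
    { carrier := {x | ∀ a b, ρ x.1 a b → x.2 a = b}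
      mul_mem' := by
        rintro ⟨x, π⟩ ⟨y, τ⟩ hx hy _ _ ⟨r, p, h, rfl, rfl⟩
        have h : r.1 * (x * y) = p.1 := h
        rw [← mul_assoc] at h
        have hq : r.1 * x ∈ rClass s := by
          obtain ⟨y', hy'⟩ := p.2.1
          obtain ⟨z, hz⟩ := r.2.2
          exact ⟨⟨y * y', by rw [← mul_assoc, h, hy']⟩, z * x, by rw [← mul_assoc, hz]⟩
        have h1 : τ (Quotient.mk σ p) = Quotient.mk σ ⟨_, hq⟩ := hy _ _ ⟨_, _, h, rfl, rfl⟩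
        have h2 : π (Quotient.mk σ ⟨_, hq⟩) = Quotient.mk σ r := hx _ _ ⟨_, _, rfl, rfl, rfl⟩
        change π (τ _) = _
        rw [h1, h2] }
  have hmem := hII (Equiv.Perm (Quotient σ)) R fun x => exists_perm_of_biUnique (ρ x) (hρ x)
  obtain ⟨x, hx⟩ := hreg
  have hs : s ∈ rClass s := ⟨⟨x * s, by rw [← mul_assoc, hx]⟩, x * s, by rw [← mul_assoc, hx]⟩
  have he : s * x ∈ rClass s := ⟨⟨s, hx⟩, x, rfl⟩
  have key : Quotient.mk σ ⟨s, hs⟩ = Quotient.mk σ ⟨s * x, he⟩ :=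
    hmem _ _ ⟨⟨s * x, he⟩, ⟨s, hs⟩, hx, rfl, rfl⟩
  obtain ⟨d, hd, h⟩ := Quotient.exact key.symm
  have h : s * x * d = s := h
  exact h ▸ mul_mem (idempotent_mem_DSub (by rw [← mul_assoc, hx])) hd
end

section
/- (Simon's theorem) Let A be a finite alphabet and L a language over A. Then L is piecewise testable if and only if the syntactic congruence ≈_L has finitely many equivalence classes and the syntactic monoid of L is J-trivial, i.e., for all words x, y: if there exist words u, v with uyv ≈_L x and words u', v' with u'xv' ≈_L y, then x ≈_L y. -/
/-- The syntactic congruence of a language `L`: `x ≈_L y` iff for all words `u, v`,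
`u ++ x ++ v ∈ L ↔ u ++ y ++ v ∈ L`. -/
def SynRel {A : Type} (L : Set (List A)) (x y : List A) : Prop :=
  ∀ u v : List A, (u ++ x ++ v ∈ L ↔ u ++ y ++ v ∈ L)

/-- The syntactic congruence as a setoid on words. -/
def synSetoid {A : Type} (L : Set (List A)) : Setoid (List A) where
  r := SynRel L
  iseqv := ⟨fun _ _ _ => Iff.rfl, fun h u v => (h u v).symm,
    fun h h' u v => (h u v).trans (h' u v)⟩

/-- The piecewise testable languages over `A`: the Boolean closure (finite unions, finite
intersections and complements) of the languages `[a₁⋯a_k] = {u | a₁⋯a_k is a scattered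
subword of u}` (the case `k = 0` giving the full language). -/
inductive PiecewiseTestable {A : Type} : Set (List A) → Prop
  | piece (w : List A) : PiecewiseTestable {u : List A | w.Sublist u}
  | union {L₁ L₂ : Set (List A)} : PiecewiseTestable L₁ → PiecewiseTestable L₂ →
      PiecewiseTestable (L₁ ∪ L₂)
  | inter {L₁ L₂ : Set (List A)} : PiecewiseTestable L₁ → PiecewiseTestable L₂ →
      PiecewiseTestable (L₁ ∩ L₂)
  | compl {L : Set (List A)} : PiecewiseTestable L → PiecewiseTestable Lᶜ

open scoped List

/-- Two words are `n`-equivalent if they have the same scattered subwords of length at most `n`. -/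
def SubwordEquiv {A : Type} (n : ℕ) (u v : List A) : Prop :=
  ∀ w : List A, w.length ≤ n → (w <+ u ↔ w <+ v)

namespace SubwordEquiv

variable {A : Type} {n m : ℕ} {u v w : List A}

theorem symm (h : SubwordEquiv n u v) : SubwordEquiv n v u := fun w hw => (h w hw).symm

theorem trans (h : SubwordEquiv n u v) (h' : SubwordEquiv n v w) : SubwordEquiv n u w :=
  fun x hx => (h x hx).trans (h' x hx)

theorem mono (h : SubwordEquiv n u v) (hmn : m ≤ n) : SubwordEquiv m u v :=
  fun w hw => h w (hw.trans hmn)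

theorem left_of_sublist (h : SubwordEquiv n u w) (huv : u <+ v) (hvw : v <+ w) :
    SubwordEquiv n u v :=
  fun x hx => ⟨fun hu => hu.trans huv, fun hv => (h x hx).2 (hv.trans hvw)⟩

theorem append {u' v' : List A} (h : SubwordEquiv n u v) (h' : SubwordEquiv n u' v') :
    SubwordEquiv n (u ++ u') (v ++ v') := by
  intro w hw
  simp only [List.sublist_append_iff]
  refine exists_congr fun l₁ => exists_congr fun l₂ => and_congr_right fun hl => ?_
  have hlen : l₁.length + l₂.length ≤ n := by simpa [hl] using hw
  exact and_congr (h l₁ (by omega)) (h' l₂ (by omega))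

theorem reverse (h : SubwordEquiv n u v) : SubwordEquiv n u.reverse v.reverse := by
  intro w hw
  have := h w.reverse (by simpa using hw)
  rwa [← List.reverse_sublist, List.reverse_reverse, ← List.reverse_sublist (l₂ := v),
    List.reverse_reverse] at this

/-- If a superword is not equivalent to the original word, some short word separates them. -/
theorem exists_of_not (h : ¬ SubwordEquiv n u v) (huv : u <+ v) :
    ∃ x : List A, x.length ≤ n ∧ x <+ v ∧ ¬ x <+ u := by
  by_contra! hc
  exact h fun x hx => ⟨fun hu => hu.trans huv, hc x hx⟩

end SubwordEquiv

/-- A subword of `r ++ t` starting with `p ++ [a]`, which does not fit into `r`, has its part from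
that `a` on inside `t`. -/
theorem cons_sublist_of_append_sublist_append {A : Type} {p q r t : List A} {a : A}
    (h : p ++ a :: q <+ r ++ t) (hr : ¬ p ++ [a] <+ r) : a :: q <+ t := by
  obtain ⟨l₁, l₂, hl, h₁, h₂⟩ := List.sublist_append_iff.1 h
  rcases List.append_eq_append_iff.1 hl with ⟨c, rfl, hc⟩ | ⟨c, rfl, rfl⟩
  · cases c with
    | nil => simpa [hc] using h₂
    | cons b c =>
      obtain ⟨rfl, rfl⟩ : a = b ∧ q = c ++ l₂ := by simpa using hc
      refine absurd (List.Sublist.trans ?_ h₁) hr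
      exact (List.Sublist.refl p).append (by simp)
  · exact (List.sublist_append_right _ _).trans h₂

/-- A subword of `r ++ b :: s` which is not a subword of `r ++ s` must use the letter `b`. -/
theorem exists_split_of_sublist_insert {A : Type} {r s x : List A} {b : A}
    (h : x <+ r ++ b :: s) (hx : ¬ x <+ r ++ s) :
    ∃ x₁ x₂ : List A, x = x₁ ++ b :: x₂ ∧ x₁ <+ r ∧ x₂ <+ s := by
  obtain ⟨l₁, l₂, rfl, h₁, h₂⟩ := List.sublist_append_iff.1 h
  rcases List.sublist_cons_iff.1 h₂ with h₂ | ⟨t, rfl, ht⟩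
  · exact absurd (h₁.append h₂) hx
  · exact ⟨l₁, t, rfl, h₁, ht⟩

/-- Removing one leading occurrence of a letter. -/
theorem exists_sublist_of_sublist_cons {A : Type} {x s : List A} {a : A} (h : x <+ a :: s) :
    ∃ z : List A, z <+ s ∧ x <+ a :: z ∧ z.length ≤ x.length := by
  rcases List.sublist_cons_iff.1 h with h | ⟨t, rfl, ht⟩
  · exact ⟨x, h, List.sublist_cons_self _ _, le_rfl⟩
  · exact ⟨t, ht, List.Sublist.refl _, by simp⟩

theorem not_append_singleton_sublist {A : Type} {p r : List A} {a b : A} (hab : a ≠ b)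
    (h : ¬ p ++ [a] <+ r) : ¬ p ++ [a] <+ r ++ [b] := by
  intro h'
  have := cons_sublist_of_append_sublist_append h' h
  simp [hab] at this

/-- If `r ++ a :: s` and `r ++ b :: t` are equivalent, the letters at which they branch can be
merged in one of the two words. -/
theorem SubwordEquiv.insert_of_branch {A : Type} {n : ℕ} {r s t : List A} {a b : A} (hab : a ≠ b)
    (h : SubwordEquiv n (r ++ a :: s) (r ++ b :: t)) :
    SubwordEquiv n (r ++ a :: s) (r ++ b :: a :: s) ∨
      SubwordEquiv n (r ++ b :: t) (r ++ a :: b :: t) := by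
  have key : ∀ {a b : A} {s t x₁ x₂ y₁ z : List A}, a ≠ b →
      SubwordEquiv n (r ++ a :: s) (r ++ b :: t) → (x₁ ++ b :: x₂).length ≤ n →
      ¬ x₁ ++ b :: x₂ <+ r ++ a :: s → x₁ <+ r → ¬ y₁ ++ [a] <+ r → y₁ <+ r →
      z <+ s → x₂ <+ a :: z → ¬ (y₁ ++ a :: z).length ≤ n := by
    intro a b s t x₁ x₂ y₁ z hab h hx hxu hx₁ hy hy₁ hz hxz hlen
    have hv : y₁ ++ a :: z <+ (r ++ [b]) ++ t := by
      simpa using (h _ hlen).1 (hy₁.append (hz.cons_cons a))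
    have ht := cons_sublist_of_append_sublist_append hv (not_append_singleton_sublist hab hy)
    exact hxu ((h _ hx).2 (hx₁.append ((hxz.trans ht).cons_cons b)))
  by_contra! hc
  obtain ⟨x, hxn, hx, hxu⟩ := SubwordEquiv.exists_of_not hc.1
    ((List.Sublist.refl r).append (List.sublist_cons_self _ _))
  obtain ⟨y, hyn, hy, hyv⟩ := SubwordEquiv.exists_of_not hc.2
    ((List.Sublist.refl r).append (List.sublist_cons_self _ _))
  obtain ⟨x₁, x₂, rfl, hx₁, hx₂⟩ := exists_split_of_sublist_insert hx hxu
  obtain ⟨y₁, y₂, rfl, hy₁, hy₂⟩ := exists_split_of_sublist_insert hy hyv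
  have hxr : ¬ x₁ ++ [b] <+ r := fun h' => hxu (by simpa using h'.append hx₂)
  have hyr : ¬ y₁ ++ [a] <+ r := fun h' => hyv (by simpa using h'.append hy₂)
  obtain ⟨x₃, hx₃, hx₂₃, hxl⟩ := exists_sublist_of_sublist_cons hx₂
  obtain ⟨y₃, hy₃, hy₂₃, hyl⟩ := exists_sublist_of_sublist_cons hy₂
  have h₁ := key hab h hxn hxu hx₁ hyr hy₁ hx₃ hx₂₃
  have h₂ := key hab.symm h.symm hyn hyv hy₁ hxr hx₁ hy₃ hy₂₃
  simp only [List.length_append, List.length_cons] at *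
  omega

/-- Two words either are comparable for the prefix order or branch at distinct letters. -/
theorem isPrefix_or_branch {A : Type} (u v : List A) :
    u <+: v ∨ v <+: u ∨
      ∃ (r s t : List A) (a b : A), a ≠ b ∧ u = r ++ a :: s ∧ v = r ++ b :: t := by
  induction u generalizing v with
  | nil => exact Or.inl (List.nil_prefix)
  | cons a u ih =>
    cases v with
    | nil => exact Or.inr (Or.inl List.nil_prefix)
    | cons b v =>
      by_cases hab : a = b
      · subst hab
        rcases ih v with h | h | ⟨r, s, t, c, d, hcd, rfl, rfl⟩
        · exact Or.inl (by simpa using h)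
        · exact Or.inr (Or.inl (by simpa using h))
        · exact Or.inr (Or.inr ⟨a :: r, s, t, c, d, hcd, rfl, rfl⟩)
      · exact Or.inr (Or.inr ⟨[], u, v, a, b, hab, rfl, rfl⟩)

/-- Equivalent words have a common superword which is equivalent to both. -/
theorem SubwordEquiv.exists_common_superword {A : Type} {n : ℕ} {u v : List A}
    (h : SubwordEquiv n u v) :
    ∃ w : List A, u <+ w ∧ v <+ w ∧ SubwordEquiv n u w ∧ SubwordEquiv n v w := by
  have key : ∀ (k : ℕ) (r s t : List A), s.length + t.length ≤ k →
      SubwordEquiv n (r ++ s) (r ++ t) →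
      ∃ w : List A, r ++ s <+ w ∧ r ++ t <+ w ∧ SubwordEquiv n (r ++ s) w ∧
        SubwordEquiv n (r ++ t) w := by
    intro k
    induction k with
    | zero =>
      intro r s t hk h
      obtain ⟨rfl, rfl⟩ : s = [] ∧ t = [] := by
        constructor <;> apply List.eq_nil_of_length_eq_zero <;> omega
      exact ⟨_, List.Sublist.refl _, List.Sublist.refl _, h, h⟩
    | succ k ih =>
      intro r s t hk h
      rcases isPrefix_or_branch s t with hp | hp | ⟨c, s, t, a, b, hab, rfl, rfl⟩
      · exact ⟨r ++ t, (List.Sublist.refl r).append hp.sublist, List.Sublist.refl _, h,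
          fun _ _ => Iff.rfl⟩
      · exact ⟨r ++ s, List.Sublist.refl _, (List.Sublist.refl r).append hp.sublist,
          fun _ _ => Iff.rfl, h.symm⟩
      · simp only [← List.append_assoc] at h ⊢
        simp only [List.length_append, List.length_cons] at hk
        generalize r ++ c = r at h ⊢
        rcases h.insert_of_branch hab with h' | h'
        · obtain ⟨w, h₁, h₂, h₃, h₄⟩ := ih (r ++ [b]) (a :: s) t
            (by simp only [List.length_cons]; omega) (by simpa using h'.symm.trans h)
          simp only [List.append_assoc, List.singleton_append] at h₁ h₂ h₃ h₄
          exact ⟨w, ((List.Sublist.refl r).append (List.sublist_cons_self _ _)).trans h₁, h₂,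
            h'.trans h₃, h₄⟩
        · obtain ⟨w, h₁, h₂, h₃, h₄⟩ := ih (r ++ [a]) s (b :: t)
            (by simp only [List.length_cons]; omega) (by simpa using h.trans h')
          simp only [List.append_assoc, List.singleton_append] at h₁ h₂ h₃ h₄
          exact ⟨w, h₁, ((List.Sublist.refl r).append (List.sublist_cons_self _ _)).trans h₂,
            h₃, h'.trans h₄⟩
  simpa using key _ [] u v le_rfl h

/-- If inserting `a` between `x` and `y` preserves subwords of length `2 * n`, then `a` is absorbed
by `x` or by `y` up to length `n`. -/
theorem SubwordEquiv.absorb {A : Type} {n : ℕ} {x y : List A} {a : A}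
    (h : SubwordEquiv (2 * n) (x ++ y) (x ++ a :: y)) :
    SubwordEquiv n x (x ++ [a]) ∨ SubwordEquiv n y (a :: y) := by
  by_contra! hc
  obtain ⟨p, hpn, hp, hpx⟩ := SubwordEquiv.exists_of_not hc.1 (List.sublist_append_left _ _)
  obtain ⟨q, hqn, hq, hqy⟩ := SubwordEquiv.exists_of_not hc.2 (List.sublist_cons_self _ _)
  obtain ⟨p₁, p₂, rfl, hp₁, hp₂⟩ := exists_split_of_sublist_insert hp (by simpa using hpx)
  obtain rfl := List.sublist_nil.1 hp₂
  rcases List.sublist_cons_iff.1 hq with hq' | ⟨q, rfl, hq'⟩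
  · exact hqy hq'
  · simp only [List.length_append, List.length_cons, List.length_nil] at hpn hqn
    refine hqy (cons_sublist_of_append_sublist_append ((h _ ?_).2 ?_) hpx)
    · simp only [List.length_append, List.length_cons]; omega
    · exact hp₁.append (hq'.cons_cons a)

section Absorption

variable {A Q : Type} [Finite Q] (f : List A → Q)

/-- A finite right congruence with trivial `R`-classes admits, for every word `x`, a short subword
witnessing every letter which moves the class of `x`. -/
theorem exists_witness_subword (hf : ∀ x y z, f x = f y → f (x ++ z) = f (y ++ z))
    (hR : ∀ x y z, f (x ++ y ++ z) = f x → f (x ++ y) = f x) (x : List A) :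
    ∃ w : List A, w.length < {c | ∃ p z, f p = c ∧ f (p ++ z) = f x}.ncard ∧ w <+ x ∧
      ∀ a, f (x ++ [a]) ≠ f x → ¬ w ++ [a] <+ x := by
  induction x using List.reverseRecOn with
  | nil =>
    refine ⟨[], (Set.ncard_pos (Set.toFinite _)).2 ⟨f [], [], [], rfl, rfl⟩,
      List.Sublist.refl _, by simp⟩
  | append_singleton x b ih =>
    obtain ⟨w, hw, hwx, hwa⟩ := ih
    by_cases hb : f (x ++ [b]) = f x
    · refine ⟨w, by rwa [hb], hwx.trans (List.sublist_append_left _ _), fun a ha h => ?_⟩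
      rw [hb, hf _ _ [a] hb] at ha
      exact not_append_singleton_sublist (by rintro rfl; exact ha hb) (hwa a ha) h
    · refine ⟨w ++ [b], ?_, hwx.append (List.Sublist.refl _), fun a _ h => ?_⟩
      · have hlt : {c | ∃ p z, f p = c ∧ f (p ++ z) = f x}.ncard <
            {c | ∃ p z, f p = c ∧ f (p ++ z) = f (x ++ [b])}.ncard := by
          refine Set.ncard_lt_ncard ⟨?_, fun hsub => ?_⟩ (Set.toFinite _)
          · rintro c ⟨p, z, rfl, hz⟩
            exact ⟨p, z ++ [b], rfl, by simpa using hf _ _ [b] hz⟩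
          · obtain ⟨p, z, hp, hz⟩ := hsub ⟨x ++ [b], [], rfl, by simp⟩
            exact hb (hR x [b] z ((hf _ _ z hp).symm.trans hz))
        simp only [List.length_append, List.length_singleton]
        omega
      · have hb' := cons_sublist_of_append_sublist_append (q := [a]) (by simpa using h) (hwa b hb)
        simpa using hb'.length_le

/-- A letter absorbed by `x` up to length `|Q|` does not move the class of `x`. -/
theorem append_singleton_eq_of_subwordEquiv
    (hf : ∀ x y z, f x = f y → f (x ++ z) = f (y ++ z))
    (hR : ∀ x y z, f (x ++ y ++ z) = f x → f (x ++ y) = f x) {x : List A} {a : A}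
    (h : SubwordEquiv (Nat.card Q) x (x ++ [a])) : f (x ++ [a]) = f x := by
  by_contra hne
  obtain ⟨w, hw, hwx, hwa⟩ := exists_witness_subword f hf hR x
  have hcard := hw.trans_le (Set.ncard_le_card _)
  exact hwa a hne ((h _ (by simpa using hcard)).2 (hwx.append (List.Sublist.refl [a])))

/-- On a finite two-sided congruence with trivial `R`- and `L`-classes, words with the same subwords
of length at most `2 * |Q|` are congruent. -/
theorem eq_of_subwordEquiv (hr : ∀ x y z, f x = f y → f (x ++ z) = f (y ++ z))
    (hl : ∀ x y z, f x = f y → f (z ++ x) = f (z ++ y))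
    (hR : ∀ x y z, f (x ++ y ++ z) = f x → f (x ++ y) = f x)
    (hL : ∀ x y z, f (z ++ (y ++ x)) = f x → f (y ++ x) = f x) {u v : List A}
    (h : SubwordEquiv (2 * Nat.card Q) u v) : f u = f v := by
  have insert_eq (x y : List A) (a : A)
      (h : SubwordEquiv (2 * Nat.card Q) (x ++ y) (x ++ a :: y)) :
      f (x ++ y) = f (x ++ a :: y) := by
    rcases h.absorb with h | h
    · simpa using hr _ _ y (append_singleton_eq_of_subwordEquiv f hr hR h).symm
    · have := append_singleton_eq_of_subwordEquiv (fun x => f x.reverse)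
        (fun x y z hxy => by simpa using hl _ _ z.reverse hxy)
        (fun x y z hxy => by simpa using hL x.reverse y.reverse z.reverse (by simpa using hxy))
        (x := y.reverse) (a := a) (by simpa using h.reverse)
      exact hl _ _ x (by simpa using this.symm)
  have sublist_eq {u v : List A} (huv : u <+ v) : ∀ c : List A,
      SubwordEquiv (2 * Nat.card Q) (c ++ u) (c ++ v) → f (c ++ u) = f (c ++ v) := by
    induction huv with
    | slnil => intros; rfl
    | @cons u v a huv ih =>
      intro c h
      have h' := h.left_of_sublist ((List.Sublist.refl c).append huv)
        ((List.Sublist.refl c).append (List.sublist_cons_self a v))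
      exact (ih c h').trans (insert_eq c v a (h'.symm.trans h))
    | @cons_cons u v a huv ih =>
      intro c h
      simpa using ih (c ++ [a]) (by simpa using h)
  obtain ⟨w, hu, hv, huw, hvw⟩ := h.exists_common_superword
  exact (sublist_eq hu [] huw).trans (sublist_eq hv [] hvw).symm

end Absorption

namespace SynRel

variable {A : Type} {L : Set (List A)} {x y z : List A}

theorem symm (h : SynRel L x y) : SynRel L y x := (synSetoid L).symm h

theorem trans (h : SynRel L x y) (h' : SynRel L y z) : SynRel L x z := (synSetoid L).trans h h'

theorem append_append (h : SynRel L x y) (p q : List A) :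
    SynRel L (p ++ x ++ q) (p ++ y ++ q) := by
  intro u v
  simpa using h (u ++ p) (q ++ v)

end SynRel

section PiecewiseTestable

variable {A : Type}

theorem PiecewiseTestable.univ : PiecewiseTestable (Set.univ : Set (List A)) := by
  have h := PiecewiseTestable.piece ([] : List A)
  simpa using h

theorem PiecewiseTestable.empty : PiecewiseTestable (∅ : Set (List A)) := by
  have h := (PiecewiseTestable.univ (A := A)).compl
  simpa using h

/-- A language that only depends on which words of a finite set `W` are subwords is piecewise
testable. -/
theorem piecewiseTestable_of_finite {W : Set (List A)} (hW : W.Finite) (L : Set (List A))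
    (hL : ∀ u v, (∀ w ∈ W, (w <+ u ↔ w <+ v)) → u ∈ L → v ∈ L) : PiecewiseTestable L := by
  induction W, hW using Set.Finite.induction_on generalizing L with
  | empty =>
    rcases L.eq_empty_or_nonempty with rfl | ⟨u, hu⟩
    · exact PiecewiseTestable.empty
    · have : L = Set.univ := Set.eq_univ_of_forall fun v => hL u v (by simp) hu
      exact this ▸ PiecewiseTestable.univ
  | @insert w W _ _ ih =>
    have hpt (p : Prop) :
        PiecewiseTestable {v | ∃ u ∈ L, (w <+ u ↔ p) ∧ ∀ x ∈ W, (x <+ u ↔ x <+ v)} :=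
      ih _ fun v v' h ⟨u, hu, hw, hx⟩ =>
        ⟨u, hu, hw, fun x hxW => (hx x hxW).trans (h x hxW)⟩
    have := ((PiecewiseTestable.piece w).inter (hpt True)).union
      ((PiecewiseTestable.piece w).compl.inter (hpt False))
    convert this using 1
    ext v
    constructor
    · intro hv
      by_cases hw : w <+ v
      · exact Or.inl ⟨hw, v, hv, by simp [hw], fun _ _ => Iff.rfl⟩
      · exact Or.inr ⟨hw, v, hv, by simp [hw], fun _ _ => Iff.rfl⟩
    · rintro (⟨hw, u, hu, hwu, h⟩ | ⟨hw, u, hu, hwu, h⟩)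
      · refine hL u v (Set.forall_mem_insert.2 ⟨?_, h⟩) hu
        exact iff_of_true (hwu.2 trivial) hw
      · refine hL u v (Set.forall_mem_insert.2 ⟨?_, h⟩) hu
        exact iff_of_false hwu.1 hw

/-- Membership in a piecewise testable language depends on the subwords of bounded length. -/
theorem PiecewiseTestable.exists_bound {L : Set (List A)} (hL : PiecewiseTestable L) :
    ∃ n, ∀ u v, SubwordEquiv n u v → (u ∈ L ↔ v ∈ L) := by
  induction hL with
  | piece w => exact ⟨w.length, fun _ _ h => h w le_rfl⟩
  | union _ _ ih₁ ih₂ =>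
    obtain ⟨n, hn⟩ := ih₁
    obtain ⟨m, hm⟩ := ih₂
    exact ⟨max n m, fun u v h => or_congr (hn u v (h.mono (le_max_left _ _)))
      (hm u v (h.mono (le_max_right _ _)))⟩
  | inter _ _ ih₁ ih₂ =>
    obtain ⟨n, hn⟩ := ih₁
    obtain ⟨m, hm⟩ := ih₂
    exact ⟨max n m, fun u v h => and_congr (hn u v (h.mono (le_max_left _ _)))
      (hm u v (h.mono (le_max_right _ _)))⟩
  | compl _ ih =>
    obtain ⟨n, hn⟩ := ih
    exact ⟨n, fun u v h => not_congr (hn u v h)⟩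

theorem SubwordEquiv.synRel {n : ℕ} {L : Set (List A)}
    (hL : ∀ u v, SubwordEquiv n u v → (u ∈ L ↔ v ∈ L)) {x y : List A}
    (h : SubwordEquiv n x y) : SynRel L x y :=
  fun _ _ => hL _ _ (SubwordEquiv.append (SubwordEquiv.append (fun _ _ => Iff.rfl) h)
    fun _ _ => Iff.rfl)

/-- The short subwords of a word. -/
def shortSubwords (n : ℕ) (u : List A) : Set {w : List A // w.length ≤ n} :=
  {w | w.1 <+ u}

theorem subwordEquiv_of_shortSubwords_eq {n : ℕ} {u v : List A}
    (h : shortSubwords n u = shortSubwords n v) : SubwordEquiv n u v :=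
  fun w hw => Set.ext_iff.1 h ⟨w, hw⟩

variable [Finite A]

instance finite_set_short_words (n : ℕ) : Finite (Set {w : List A // w.length ≤ n}) :=
  have : Finite {w : List A // w.length ≤ n} := List.finite_length_le A n
  inferInstance

theorem PiecewiseTestable.finite_quotient {L : Set (List A)} (hL : PiecewiseTestable L) :
    Finite (Quotient (synSetoid L)) := by
  obtain ⟨n, hn⟩ := hL.exists_bound
  refine Finite.of_injective (fun q : Quotient (synSetoid L) => shortSubwords n q.out)
    fun q q' h => ?_
  exact Quotient.out_equiv_out.1 ((subwordEquiv_of_shortSubwords_eq h).synRel hn)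

theorem PiecewiseTestable.jTrivial {L : Set (List A)} (hL : PiecewiseTestable L)
    {x y u v u' v' : List A} (hx : SynRel L (u ++ y ++ v) x) (hy : SynRel L (u' ++ x ++ v') y) :
    SynRel L x y := by
  obtain ⟨n, hn⟩ := hL.exists_bound
  let g : List A → List A := fun z => u ++ (u' ++ z ++ v') ++ v
  have hg (z : List A) : z <+ u' ++ z ++ v' ∧ u' ++ z ++ v' <+ g z := by
    constructor
    · exact (List.sublist_append_right _ _).trans (List.sublist_append_left _ _)
    · exact (List.sublist_append_right _ _).trans (List.sublist_append_left _ _)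
  have hmono {i j : ℕ} (hij : i ≤ j) : g^[i] x <+ g^[j] x := by
    induction j, hij using Nat.le_induction with
    | base => exact List.Sublist.refl _
    | succ j _ ih =>
      rw [Function.iterate_succ_apply']
      exact ih.trans ((hg _).1.trans (hg _).2)
  have hrel (i : ℕ) : SynRel L (g^[i] x) x := by
    induction i with
    | zero => exact (synSetoid L).refl x
    | succ i ih =>
      rw [Function.iterate_succ_apply']
      exact (((ih.append_append u' v').trans hy).append_append u v).trans hx
  obtain ⟨i, j, hij, h⟩ : ∃ i j, i < j ∧ shortSubwords n (g^[i] x) = shortSubwords n (g^[j] x) := by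
    obtain ⟨i, j, hij, h⟩ :=
      Finite.exists_ne_map_eq_of_infinite fun i : ℕ => shortSubwords n (g^[i] x)
    rcases hij.lt_or_gt with hij | hij
    · exact ⟨i, j, hij, h⟩
    · exact ⟨j, i, hij, h.symm⟩
  have hmid : g (g^[i] x) <+ g^[j] x := by
    have := hmono (Nat.succ_le_of_lt hij)
    rwa [Function.iterate_succ_apply'] at this
  have heq := ((subwordEquiv_of_shortSubwords_eq h).left_of_sublist (hg _).1
    ((hg _).2.trans hmid)).synRel hn
  exact (hrel i).symm.trans (heq.trans (((hrel i).append_append u' v').trans hy))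

theorem piecewiseTestable_of_jTrivial {L : Set (List A)} [Finite (Quotient (synSetoid L))]
    (hJ : ∀ x y : List A, (∃ u v : List A, SynRel L (u ++ y ++ v) x) →
      (∃ u' v' : List A, SynRel L (u' ++ x ++ v') y) → SynRel L x y) :
    PiecewiseTestable L := by
  have heq {x y : List A} :
      (Quotient.mk (synSetoid L) x = Quotient.mk (synSetoid L) y) ↔ SynRel L x y :=
    Quotient.eq
  refine piecewiseTestable_of_finite
    (List.finite_length_le A (2 * Nat.card (Quotient (synSetoid L)))) L fun u v h hu => ?_
  have hf := eq_of_subwordEquiv (Quotient.mk (synSetoid L))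
    (fun x y z hxy => heq.2 (by simpa using (heq.1 hxy).append_append [] z))
    (fun x y z hxy => heq.2 (by simpa using (heq.1 hxy).append_append z []))
    (fun x y z hxy => heq.2 (hJ _ _ ⟨[], y, (synSetoid L).refl _⟩ ⟨[], z, heq.1 hxy⟩))
    (fun x y z hxy => heq.2 (hJ _ _ ⟨y, [], by rw [List.append_nil]; exact (synSetoid L).refl _⟩
      ⟨z, [], by simpa using heq.1 hxy⟩)) (u := u) (v := v) h
  simpa [hu] using heq.1 hf [] []

end PiecewiseTestable

/-- Simon's theorem: a language `L` over a finite alphabet is piecewise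
testable iff its syntactic congruence has finitely many classes and its syntactic monoid is
`J`-trivial: whenever `uyv ≈_L x` and `u'xv' ≈_L y` for some words `u, v, u', v'`, one has
`x ≈_L y`. -/
theorem simon_piecewise_testable {A : Type} [Fintype A] (L : Set (List A)) :
    PiecewiseTestable L ↔
      Finite (Quotient (synSetoid L)) ∧
      ∀ x y : List A,
        (∃ u v : List A, SynRel L (u ++ y ++ v) x) →
        (∃ u' v' : List A, SynRel L (u' ++ x ++ v') y) →
        SynRel L x y := by
  constructor
  · intro h
    exact ⟨h.finite_quotient, fun x y ⟨_, _, hx⟩ ⟨_, _, hy⟩ => h.jTrivial hx hy⟩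
  · rintro ⟨_, hJ⟩
    exact piecewiseTestable_of_jTrivial hJ
end
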